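/- arXiv:2402.06024 — 2 statements merged into one kernel-verified Lean document; each statement's English description precedes it below -/
import Mathlib

section
/- Let G be a coalition with ∅ ≠ G ≠ N, let Y ⊆ X be a set of three distinct alternatives, and let F be an SWF on a domain D satisfying unanimity and IIA. Assume D_1(G,Y) ⊆ D|_Y or D_2(G,Y) ⊆ D|_Y. Then for all distinct α,β,γ ∈ Y and every profile P ∈ D such that either [for all i, (β P_i γ iff i ∈ G) and (α P_i β iff i ∉ G)] or [for all i, (β P_i γ iff i ∉ G) and (α P_i β iff i ∈ G)], the social preference satisfies: F(P) ranks β above γ if and only if F(P) ranks β above α. -/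
open Set
namespace ArrowSC

/-- A profile assigns to each voter a binary relation (their preference) on alternatives. -/
abbrev Profile (n : ℕ) (X : Type*) := Fin n → X → X → Prop

/-- `r` is a strict total order. -/
def IsSTO {X : Type*} (r : X → X → Prop) : Prop :=
  (∀ x, ¬ r x x) ∧ (∀ x y z, r x y → r y z → r x z) ∧
  (∀ x y, x ≠ y → r x y ∨ r y x)

/-- A genuine profile: every voter's relation is a strict total order, i.e. a member of W(X)^n. -/
def IsProfile {n : ℕ} {X : Type*} (P : Profile n X) : Prop := ∀ i, IsSTO (P i)

/-- A domain: a nonempty set of profiles, each a member of W(X)^n. -/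
def IsDomain {n : ℕ} {X : Type*} (D : Set (Profile n X)) : Prop :=
  D.Nonempty ∧ ∀ P ∈ D, IsProfile P

/-- `F` is a social welfare function on `D`: it sends each profile in `D` to a strict total order. -/
def IsSWF {n : ℕ} {X : Type*} (D : Set (Profile n X))
    (F : Profile n X → X → X → Prop) : Prop :=
  ∀ P ∈ D, IsSTO (F P)

def Unanimity {n : ℕ} {X : Type*} (D : Set (Profile n X))
    (F : Profile n X → X → X → Prop) : Prop :=
  ∀ P ∈ D, ∀ a b : X, (∀ i, P i a b) → F P a b

def IIA {n : ℕ} {X : Type*} (D : Set (Profile n X))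
    (F : Profile n X → X → X → Prop) : Prop :=
  ∀ P ∈ D, ∀ P' ∈ D, ∀ a b : X, (∀ i, P i a b ↔ P' i a b) → (F P a b ↔ F P' a b)

def IsDictator {n : ℕ} {X : Type*} (D : Set (Profile n X))
    (F : Profile n X → X → X → Prop) (d : Fin n) : Prop :=
  ∀ P ∈ D, ∀ a b : X, P d a b → F P a b

def Dictatorial {n : ℕ} {X : Type*} (D : Set (Profile n X))
    (F : Profile n X → X → X → Prop) : Prop :=
  ∃ d, IsDictator D F d

/-- Coalition `G` is almost-decisive over the ordered pair `(a, b)` w.r.t. `F`. -/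
def AlmostDecisivePair {n : ℕ} {X : Type*} (D : Set (Profile n X))
    (F : Profile n X → X → X → Prop) (G : Set (Fin n)) (a b : X) : Prop :=
  ∀ P ∈ D, (∀ i, P i a b ↔ i ∈ G) → F P a b

/-- Coalition `G` is almost-decisive over `Y` w.r.t. `F`. -/
def AlmostDecisiveOn {n : ℕ} {X : Type*} (D : Set (Profile n X))
    (F : Profile n X → X → X → Prop) (G : Set (Fin n)) (Y : Set X) : Prop :=
  ∀ a ∈ Y, ∀ b ∈ Y, a ≠ b → AlmostDecisivePair D F G a b

/-- Coalition `G` is almost-decisive (over all of X) w.r.t. `F`. -/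
def AlmostDecisive {n : ℕ} {X : Type*} (D : Set (Profile n X))
    (F : Profile n X → X → X → Prop) (G : Set (Fin n)) : Prop :=
  ∀ a b : X, a ≠ b → AlmostDecisivePair D F G a b

/-- The restriction of `r` to the triple `{a,b,c}` is the order `a` above `b` above `c`. -/
def RanksTriple {X : Type*} (r : X → X → Prop) (a b c : X) : Prop :=
  r a b ∧ r b c ∧ r a c

/-- The polarized profile `(G : abc, Gᶜ : a'b'c')` on a triple is a subprofile of `D`,
i.e. it belongs to the restriction `D|_{triple}`. -/
def HasPolarizedSubprofile {n : ℕ} {X : Type*} (D : Set (Profile n X)) (G : Set (Fin n))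
    (a b c a' b' c' : X) : Prop :=
  ∃ P ∈ D, ∀ i, (i ∈ G → RanksTriple (P i) a b c) ∧ (i ∉ G → RanksTriple (P i) a' b' c')

/-- `D_1(G, {a,b,c}) ⊆ D|_{{a,b,c}}`. -/
def D1sub {n : ℕ} {X : Type*} (D : Set (Profile n X)) (G : Set (Fin n)) (a b c : X) : Prop :=
  HasPolarizedSubprofile D G b c a a b c ∧
  HasPolarizedSubprofile D G b a c a c b ∧
  HasPolarizedSubprofile D G a b c c a b ∧
  HasPolarizedSubprofile D G a c b c b a ∧
  HasPolarizedSubprofile D G c a b b c a ∧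
  HasPolarizedSubprofile D G c b a b a c

/-- `D_2(G, {a,b,c}) ⊆ D|_{{a,b,c}}`. -/
def D2sub {n : ℕ} {X : Type*} (D : Set (Profile n X)) (G : Set (Fin n)) (a b c : X) : Prop :=
  HasPolarizedSubprofile D G a b c b c a ∧
  HasPolarizedSubprofile D G a c b b a c ∧
  HasPolarizedSubprofile D G c a b a b c ∧
  HasPolarizedSubprofile D G c b a a c b ∧
  HasPolarizedSubprofile D G b c a c a b ∧
  HasPolarizedSubprofile D G b a c c b a

/-- The class 𝒟^PT of polarization over triples. -/
def ClassPT {n : ℕ} {X : Type*} (D : Set (Profile n X)) : Prop :=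
  ∀ G : Set (Fin n), G ≠ ∅ → G ≠ univ →
    ∀ a b c : X, a ≠ b → b ≠ c → a ≠ c →
      D1sub D G a b c ∨ D2sub D G a b c

/-- The class 𝒟^DT of diversity over triples. -/
def ClassDT {n : ℕ} {X : Type*} (D : Set (Profile n X)) : Prop :=
  ∀ G G' : Set (Fin n), ¬ G ⊆ G' → ¬ G' ⊆ G →
    ∃ a b c : X, a ≠ b ∧ b ≠ c ∧ a ≠ c ∧ ∃ P ∈ D, ∀ i,
      (P i a b ↔ i ∈ G) ∧ (P i b c ↔ i ∈ G') ∧ (P i c a ↔ i ∉ G ∩ G')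

/-- `D` is Arrow-inconsistent. -/
def ArrowInconsistent {n : ℕ} {X : Type*} (D : Set (Profile n X)) : Prop :=
  ∀ F : Profile n X → X → X → Prop,
    IsSWF D F → Unanimity D F → IIA D F → Dictatorial D F

/-- `a` is the most-preferred among `{a,b,c}` according to `r`. -/
def TripleBest {X : Type*} (r : X → X → Prop) (a b c : X) : Prop := r a b ∧ r a c

/-- `a` is the least-preferred among `{a,b,c}` according to `r`. -/
def TripleWorst {X : Type*} (r : X → X → Prop) (a b c : X) : Prop := r b a ∧ r c a

/-- `a` is the middle-preferred among `{a,b,c}` according to `r`. -/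
def TripleMiddle {X : Type*} (r : X → X → Prop) (a b c : X) : Prop :=
  (r b a ∧ r a c) ∨ (r c a ∧ r a b)

/-- In profile `P`, alternative `a` is never placed as the most-preferred, or never as the
middle-preferred, or never as the least-preferred alternative among `{a,b,c}`. -/
def NeverBMW {n : ℕ} {X : Type*} (P : Profile n X) (a b c : X) : Prop :=
  (∀ i, ¬ TripleBest (P i) a b c) ∨ (∀ i, ¬ TripleMiddle (P i) a b c) ∨
  (∀ i, ¬ TripleWorst (P i) a b c)

/-- Sen's value-restriction of a profile over `Y`. -/
def ValueRestricted {n : ℕ} {X : Type*} (P : Profile n X) (Y : Set X) : Prop :=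
  ∀ a ∈ Y, ∀ b ∈ Y, ∀ c ∈ Y, a ≠ b → b ≠ c → a ≠ c →
    NeverBMW P a b c ∨ NeverBMW P b a c ∨ NeverBMW P c a b

/-- The strict total order on the triple `{a,b,c}` ranking `a` above `b` above `c`,
viewed as a relation with support in `{a,b,c}`. -/
def seqOrder {X : Type*} (a b c : X) : X → X → Prop :=
  fun x y => (x = a ∧ y = b) ∨ (x = b ∧ y = c) ∨ (x = a ∧ y = c)

/-- `r` is a strict total order on the triple `{a,b,c}` (with support in the triple). -/
def IsTripleOrder {X : Type*} (a b c : X) (r : X → X → Prop) : Prop :=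
  (∀ x y, r x y → x ∈ ({a, b, c} : Set X) ∧ y ∈ ({a, b, c} : Set X)) ∧
  (∀ x, ¬ r x x) ∧ (∀ x y z, r x y → r y z → r x z) ∧
  (∀ x ∈ ({a, b, c} : Set X), ∀ y ∈ ({a, b, c} : Set X), x ≠ y → r x y ∨ r y x)

/-- The polarized profile `(G : Q, Gᶜ : Q')`. -/
def polarizedProfile {n : ℕ} {X : Type*} (G : Set (Fin n)) (Q Q' : X → X → Prop) :
    Profile n X :=
  fun i x y => (i ∈ G ∧ Q x y) ∨ (i ∉ G ∧ Q' x y)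

/-- `Q` and `Q'` differ on how they rank the pair `{x, y}`. -/
def DifferOn {X : Type*} (Q Q' : X → X → Prop) (x y : X) : Prop := ¬ (Q x y ↔ Q' x y)

/-- `Q` and `Q'` differ on exactly two of the three unordered pairs of the triple `{a,b,c}`
and coincide on the remaining pair. -/
def StronglyPolarizedPair {X : Type*} (a b c : X) (Q Q' : X → X → Prop) : Prop :=
  (DifferOn Q Q' a b ∧ DifferOn Q Q' b c ∧ ¬ DifferOn Q Q' a c) ∨
  (DifferOn Q Q' a b ∧ ¬ DifferOn Q Q' b c ∧ DifferOn Q Q' a c) ∨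
  (¬ DifferOn Q Q' a b ∧ DifferOn Q Q' b c ∧ DifferOn Q Q' a c)

/-- The set `D_1(G, {a,b,c})` of polarized profiles on the triple `{a,b,c}`. -/
def D1set {n : ℕ} {X : Type*} (G : Set (Fin n)) (a b c : X) : Set (Profile n X) :=
  { polarizedProfile G (seqOrder b c a) (seqOrder a b c),
    polarizedProfile G (seqOrder b a c) (seqOrder a c b),
    polarizedProfile G (seqOrder a b c) (seqOrder c a b),
    polarizedProfile G (seqOrder a c b) (seqOrder c b a),
    polarizedProfile G (seqOrder c a b) (seqOrder b c a),
    polarizedProfile G (seqOrder c b a) (seqOrder b a c) }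

/-- The set `D_2(G, {a,b,c})` of polarized profiles on the triple `{a,b,c}`. -/
def D2set {n : ℕ} {X : Type*} (G : Set (Fin n)) (a b c : X) : Set (Profile n X) :=
  { polarizedProfile G (seqOrder a b c) (seqOrder b c a),
    polarizedProfile G (seqOrder a c b) (seqOrder b a c),
    polarizedProfile G (seqOrder c a b) (seqOrder a b c),
    polarizedProfile G (seqOrder c b a) (seqOrder a c b),
    polarizedProfile G (seqOrder b c a) (seqOrder c a b),
    polarizedProfile G (seqOrder b a c) (seqOrder c b a) }

/-- The set of all strongly polarized profiles on the triple `{a,b,c}`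
of the form `(G : Q, Gᶜ : Q')`. -/
def SPset {n : ℕ} {X : Type*} (G : Set (Fin n)) (a b c : X) : Set (Profile n X) :=
  { p | ∃ Q Q', IsTripleOrder a b c Q ∧ IsTripleOrder a b c Q' ∧
      StronglyPolarizedPair a b c Q Q' ∧ p = polarizedProfile G Q Q' }
/-- Some profile in which exactly the members of `G` rank `u` above `v` has `u` socially
above `v`. -/
def Wins {n : ℕ} {X : Type*} (D : Set (Profile n X)) (F : Profile n X → X → X → Prop)
    (G : Set (Fin n)) (u v : X) : Prop :=
  ∃ P ∈ D, (∀ i, P i u v ↔ i ∈ G) ∧ F P u v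

theorem IsSTO.asymm {X : Type*} {r : X → X → Prop} (h : IsSTO r) {u v : X} (huv : r u v) :
    ¬ r v u :=
  fun hvu => h.1 u (h.2.1 u v u huv hvu)

section

variable {n : ℕ} {X : Type*} {D : Set (Profile n X)} {F : Profile n X → X → X → Prop}
  {G : Set (Fin n)}

theorem Wins.social (hIIA : IIA D F) {u v : X} (h : Wins D F G u v) {P : Profile n X}
    (hP : P ∈ D) (hG : ∀ i, P i u v ↔ i ∈ G) : F P u v := by
  obtain ⟨Q, hQ, hQG, hFQ⟩ := h
  exact (hIIA Q hQ P hP u v fun i => (hQG i).trans (hG i).symm).1 hFQ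

theorem Wins.of_raise_winner (hD : IsDomain D) (hF : IsSWF D F) (hU : Unanimity D F)
    (hIIA : IIA D F) {p q r : X} (h : HasPolarizedSubprofile D G p q r r p q)
    (hw : Wins D F G q r) : Wins D F G p r := by
  obtain ⟨P, hP, hPG⟩ := h
  have hqr : ∀ i, P i q r ↔ i ∈ G := fun i =>
    ⟨fun h => by_contra fun hi => (hD.2 P hP i).asymm h ((hPG i).2 hi).2.2,
      fun hi => ((hPG i).1 hi).2.1⟩
  have hpr : ∀ i, P i p r ↔ i ∈ G := fun i =>
    ⟨fun h => by_contra fun hi => (hD.2 P hP i).asymm h ((hPG i).2 hi).1,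
      fun hi => ((hPG i).1 hi).2.2⟩
  have hpq : F P p q := hU P hP p q fun i => by
    by_cases hi : i ∈ G
    · exact ((hPG i).1 hi).1
    · exact ((hPG i).2 hi).2.1
  exact ⟨P, hP, hpr, (hF P hP).2.1 p q r hpq (hw.social hIIA hP hqr)⟩

theorem Wins.of_lower_loser (hD : IsDomain D) (hF : IsSWF D F) (hU : Unanimity D F)
    (hIIA : IIA D F) {p q r : X} (h : HasPolarizedSubprofile D G p q r q r p)
    (hw : Wins D F G p q) : Wins D F G p r := by
  obtain ⟨P, hP, hPG⟩ := h
  have hpq : ∀ i, P i p q ↔ i ∈ G := fun i =>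
    ⟨fun h => by_contra fun hi => (hD.2 P hP i).asymm h ((hPG i).2 hi).2.2,
      fun hi => ((hPG i).1 hi).1⟩
  have hpr : ∀ i, P i p r ↔ i ∈ G := fun i =>
    ⟨fun h => by_contra fun hi => (hD.2 P hP i).asymm h ((hPG i).2 hi).2.1,
      fun hi => ((hPG i).1 hi).2.2⟩
  have hqr : F P q r := hU P hP q r fun i => by
    by_cases hi : i ∈ G
    · exact ((hPG i).1 hi).2.1
    · exact ((hPG i).2 hi).1
  exact ⟨P, hP, hpr, (hF P hP).2.1 p q r (hw.social hIIA hP hpq) hqr⟩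

/-- Under `D_1` or `D_2`, the six ordered pairs of the triple imply each other in a cycle. -/
theorem wins_iff_wins (hD : IsDomain D) (hF : IsSWF D F) (hU : Unanimity D F)
    (hIIA : IIA D F) {x y z : X} (h12 : D1sub D G x y z ∨ D2sub D G x y z) :
    ∀ a ∈ ({x, y, z} : Set X), ∀ b ∈ ({x, y, z} : Set X), a ≠ b →
      (Wins D F G a b ↔ Wins D F G x y) := by
  have hcycle : (Wins D F G y x ↔ Wins D F G x y) ∧ (Wins D F G y z ↔ Wins D F G x y) ∧
      (Wins D F G z y ↔ Wins D F G x y) ∧ (Wins D F G x z ↔ Wins D F G x y) ∧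
      (Wins D F G z x ↔ Wins D F G x y) := by
    rcases h12 with ⟨h1, h2, h3, h4, h5, h6⟩ | ⟨h1, h2, h3, h4, h5, h6⟩
    · have := Wins.of_raise_winner hD hF hU hIIA h1
      have := Wins.of_lower_loser hD hF hU hIIA h2
      have := Wins.of_raise_winner hD hF hU hIIA h3
      have := Wins.of_lower_loser hD hF hU hIIA h4
      have := Wins.of_raise_winner hD hF hU hIIA h5
      have := Wins.of_lower_loser hD hF hU hIIA h6
      tauto
    · have := Wins.of_lower_loser hD hF hU hIIA h1
      have := Wins.of_raise_winner hD hF hU hIIA h2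
      have := Wins.of_lower_loser hD hF hU hIIA h3
      have := Wins.of_raise_winner hD hF hU hIIA h4
      have := Wins.of_lower_loser hD hF hU hIIA h5
      have := Wins.of_raise_winner hD hF hU hIIA h6
      tauto
  obtain ⟨hyx, hyz, hzy, hxz, hzx⟩ := hcycle
  rintro a (rfl | rfl | rfl) b (rfl | rfl | rfl) hab <;>
    first | exact absurd rfl hab | assumption | exact Iff.rfl

end

/-- Lemma "not-boundary-2": strongly polarized edges are mapped to
non-DbT edges. -/
theorem not_boundary_two {X : Type*} [Fintype X] {n : ℕ}
    (hX : 3 ≤ Fintype.card X) (hn : 2 ≤ n)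
    (D : Set (Profile n X)) (hD : IsDomain D)
    (F : Profile n X → X → X → Prop) (hF : IsSWF D F)
    (hU : Unanimity D F) (hIIA : IIA D F)
    (G : Set (Fin n)) (hGne : G ≠ ∅) (hGuniv : G ≠ univ)
    (x y z : X) (hxy : x ≠ y) (hyz : y ≠ z) (hxz : x ≠ z)
    (h12 : D1sub D G x y z ∨ D2sub D G x y z) :
    ∀ a ∈ ({x, y, z} : Set X), ∀ b ∈ ({x, y, z} : Set X), ∀ c ∈ ({x, y, z} : Set X),
      a ≠ b → b ≠ c → a ≠ c →
      ∀ P ∈ D,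
        ((∀ i, (P i b c ↔ i ∈ G) ∧ (P i a b ↔ i ∉ G)) ∨
          (∀ i, (P i b c ↔ i ∉ G) ∧ (P i a b ↔ i ∈ G))) →
        (F P b c ↔ F P b a) := by
  intro a ha b hb c hc hab hbc hac P hP hpat
  have hPi := hD.2 P hP
  have hFP := hF P hP
  have hwins := wins_iff_wins hD hF hU hIIA h12
  have hsocial : ∀ u v, (∀ i, P i u v ↔ i ∈ G) → (F P u v ↔ Wins D F G u v) :=
    fun u v huv => ⟨fun h => ⟨P, hP, huv, h⟩, fun h => h.social hIIA hP huv⟩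
  have hnot : ∀ {r : X → X → Prop}, IsSTO r → ∀ {u v}, u ≠ v → (r u v ↔ ¬ r v u) :=
    fun hr _ _ huv => ⟨hr.asymm, (hr.2.2 _ _ huv).resolve_right⟩
  rcases hpat with h | h
  · rw [hsocial b c fun i => (h i).1,
      hsocial b a fun i => by rw [hnot (hPi i) hab.symm, (h i).2, not_not],
      hwins b hb c hc hbc, hwins b hb a ha hab.symm]
  · rw [hnot hFP hbc, hnot hFP hab.symm, not_iff_not,
      hsocial c b fun i => by rw [hnot (hPi i) hbc.symm, (h i).1, not_not],
      hsocial a b fun i => (h i).2,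
      hwins c hc b hb hbc.symm, hwins a ha b hb hab]

end ArrowSC
end

section
/- Let G ⊆ N be a coalition, let Y ⊆ X be a set of three distinct alternatives, and let F be an SWF on a domain D satisfying unanimity and IIA. Assume that whenever ∅ ≠ G ≠ N, we have D_1(G,Y) ⊆ D|_Y or D_2(G,Y) ⊆ D|_Y. Then G is almost-decisive over Y w.r.t. F, or N \ G is almost-decisive over Y w.r.t. F. -/
open Set
namespace ArrowSC

theorem IsSTO.not_rel_iff {X : Type*} {r : X → X → Prop} (h : IsSTO r) {a b : X} (hab : a ≠ b) :
    ¬ r a b ↔ r b a :=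
  ⟨fun hn => (h.2.2 a b hab).resolve_left hn, fun hba hr => h.1 a (h.2.1 a b a hr hba)⟩

section

variable {X : Type*} {n : ℕ} {D : Set (Profile n X)} {F : Profile n X → X → X → Prop}
  {G : Set (Fin n)} {a b c : X}

/-- Under IIA, winning over `(a, b)` in one profile polarized on that pair suffices. -/
theorem IIA.almostDecisivePair (hIIA : IIA D F) {P : Profile n X} (hP : P ∈ D)
    (hG : ∀ i, P i a b ↔ i ∈ G) (h : F P a b) : AlmostDecisivePair D F G a b :=
  fun Q hQ hQG => (hIIA P hP Q hQ a b fun i => (hG i).trans (hQG i).symm).1 h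

theorem almostDecisivePair_univ (hU : Unanimity D F) : AlmostDecisivePair D F univ a b :=
  fun P hP h => hU P hP a b fun i => (h i).2 (mem_univ i)

theorem almostDecisivePair_compl (hD : IsDomain D) (hF : IsSWF D F) (hIIA : IIA D F)
    (hab : a ≠ b) (h : ¬ AlmostDecisivePair D F G a b) : AlmostDecisivePair D F Gᶜ b a := by
  intro P hP hPG
  refine ((hF P hP).not_rel_iff hab).1 fun hFP => h (hIIA.almostDecisivePair hP (fun i => ?_) hFP)
  rw [← not_iff_not, (hD.2 P hP i).not_rel_iff hab]
  exact hPG i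

/-- Decisiveness passes from `(a, b)` to `(a, c)` when all voters agree on `b` above `c`. -/
theorem AlmostDecisivePair.of_common_right (hD : IsDomain D) (hF : IsSWF D F)
    (hU : Unanimity D F) (hIIA : IIA D F) (hab : a ≠ b) (hac : a ≠ c)
    (hP : HasPolarizedSubprofile D G a b c b c a) (h : AlmostDecisivePair D F G a b) :
    AlmostDecisivePair D F G a c := by
  obtain ⟨P, hPD, hP⟩ := hP
  have hPab (i) : P i a b ↔ i ∈ G :=
    ⟨fun hr => by_contra fun hi =>
      ((hD.2 P hPD i).not_rel_iff hab).2 ((hP i).2 hi).2.2 hr, fun hi => ((hP i).1 hi).1⟩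
  have hPac (i) : P i a c ↔ i ∈ G :=
    ⟨fun hr => by_contra fun hi =>
      ((hD.2 P hPD i).not_rel_iff hac).2 ((hP i).2 hi).2.1 hr, fun hi => ((hP i).1 hi).2.2⟩
  have hbc : F P b c := hU P hPD b c fun i => by
    by_cases hi : i ∈ G
    exacts [((hP i).1 hi).2.1, ((hP i).2 hi).1]
  exact hIIA.almostDecisivePair hPD hPac ((hF P hPD).2.1 a b c (h P hPD hPab) hbc)

/-- Decisiveness passes from `(b, c)` to `(a, c)` when all voters agree on `a` above `b`. -/
theorem AlmostDecisivePair.of_common_left (hD : IsDomain D) (hF : IsSWF D F)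
    (hU : Unanimity D F) (hIIA : IIA D F) (hbc : b ≠ c) (hac : a ≠ c)
    (hP : HasPolarizedSubprofile D G a b c c a b) (h : AlmostDecisivePair D F G b c) :
    AlmostDecisivePair D F G a c := by
  obtain ⟨P, hPD, hP⟩ := hP
  have hPbc (i) : P i b c ↔ i ∈ G :=
    ⟨fun hr => by_contra fun hi =>
      ((hD.2 P hPD i).not_rel_iff hbc).2 ((hP i).2 hi).2.2 hr, fun hi => ((hP i).1 hi).2.1⟩
  have hPac (i) : P i a c ↔ i ∈ G :=
    ⟨fun hr => by_contra fun hi =>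
      ((hD.2 P hPD i).not_rel_iff hac).2 ((hP i).2 hi).1 hr, fun hi => ((hP i).1 hi).2.2⟩
  have hab : F P a b := hU P hPD a b fun i => by
    by_cases hi : i ∈ G
    exacts [((hP i).1 hi).1, ((hP i).2 hi).2.1]
  exact hIIA.almostDecisivePair hPD hPac ((hF P hPD).2.1 a b c hab (h P hPD hPbc))

end

/-- Lemma "dec-G-Gc-Y": `G` or its complement is almost-decisive
over the triple. -/
theorem almost_decisive_G_or_compl_on_triple {X : Type*} [Fintype X] {n : ℕ}
    (hX : 3 ≤ Fintype.card X) (hn : 2 ≤ n)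
    (D : Set (Profile n X)) (hD : IsDomain D)
    (F : Profile n X → X → X → Prop) (hF : IsSWF D F)
    (hU : Unanimity D F) (hIIA : IIA D F)
    (G : Set (Fin n))
    (x y z : X) (hxy : x ≠ y) (hyz : y ≠ z) (hxz : x ≠ z)
    (h12 : G ≠ ∅ → G ≠ univ → (D1sub D G x y z ∨ D2sub D G x y z)) :
    AlmostDecisiveOn D F G ({x, y, z} : Set X) ∨
      AlmostDecisiveOn D F Gᶜ ({x, y, z} : Set X) := by
  rcases eq_or_ne G ∅ with rfl | hG0
  · right
    rw [compl_empty]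
    exact fun a _ b _ _ => almostDecisivePair_univ hU
  rcases eq_or_ne G univ with rfl | hG1
  · exact Or.inl fun a _ b _ _ => almostDecisivePair_univ hU
  have right {a b c : X} (hab : a ≠ b) (hac : a ≠ c) :=
    AlmostDecisivePair.of_common_right (G := G) (c := c) hD hF hU hIIA hab hac
  have left {a b c : X} (hbc : b ≠ c) (hac : a ≠ c) :=
    AlmostDecisivePair.of_common_left (G := G) (a := a) hD hF hU hIIA hbc hac
  -- Either hypothesis links the six ordered pairs into a cycle of implications.
  obtain ⟨hxz', hyx', hyz', hzx', hzy'⟩ :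
      (AlmostDecisivePair D F G x z ↔ AlmostDecisivePair D F G x y) ∧
      (AlmostDecisivePair D F G y x ↔ AlmostDecisivePair D F G x y) ∧
      (AlmostDecisivePair D F G y z ↔ AlmostDecisivePair D F G x y) ∧
      (AlmostDecisivePair D F G z x ↔ AlmostDecisivePair D F G x y) ∧
      (AlmostDecisivePair D F G z y ↔ AlmostDecisivePair D F G x y) := by
    rcases h12 hG0 hG1 with ⟨h1, h2, h3, h4, h5, h6⟩ | ⟨h1, h2, h3, h4, h5, h6⟩
    · have := left hxz.symm hxy.symm h1
      have := right hxy.symm hyz h2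
      have := left hyz hxz h3
      have := right hxz hxy h4
      have := left hxy hyz.symm h5
      have := right hyz.symm hxz.symm h6
      grind only
    · have := right hxy hxz h1
      have := left hyz.symm hxy h2
      have := right hxz.symm hyz.symm h3
      have := left hxy.symm hxz.symm h4
      have := right hyz hxy.symm h5
      have := left hxz hyz h6
      grind only
  have iff_xy : ∀ a ∈ ({x, y, z} : Set X), ∀ b ∈ ({x, y, z} : Set X), a ≠ b →
      (AlmostDecisivePair D F G a b ↔ AlmostDecisivePair D F G x y) := by
    simp [hxz', hyx', hyz', hzx', hzy']
  by_cases h : AlmostDecisivePair D F G x y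
  · exact Or.inl fun a ha b hb hab => (iff_xy a ha b hb hab).2 h
  · exact Or.inr fun a ha b hb hab => almostDecisivePair_compl hD hF hIIA hab.symm
      fun hd => h ((iff_xy b hb a ha hab.symm).1 hd)

end ArrowSC
end
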